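/- Let Γ be a finitely generated amenable group. Then Γ is weakly locally stable if and only if Γ is LEF. -/

import Mathlib

open Filter Topology

open scoped Classical

/-- Normalized Hamming metric on `Sym(k)`:
`d_k(σ,τ) = |{i : σ i ≠ τ i}| / k` (which equals `1 - |{i : σ i = τ i}|/k` for `k ≥ 1`). -/
noncomputable def dHam {k : ℕ} (σ τ : Equiv.Perm (Fin k)) : ℝ :=
  ((Finset.univ.filter fun i => σ i ≠ τ i).card : ℝ) / k

/-- `(φ_n)` is an almost-homomorphism. -/
def IsAlmostHom {Γ : Type*} [Group Γ] (k : ℕ → ℕ)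
    (φ : ∀ n, Γ → Equiv.Perm (Fin (k n))) : Prop :=
  ∀ g h : Γ,
    Tendsto (fun n => dHam (φ n g * φ n h) (φ n (g * h))) atTop (𝓝 0)

/-- `(φ_n)` is a partial homomorphism. -/
def IsPartialHom {Γ : Type*} [Group Γ] (k : ℕ → ℕ)
    (φ : ∀ n, Γ → Equiv.Perm (Fin (k n))) : Prop :=
  ∀ g h : Γ, ∀ᶠ n in atTop, φ n (g * h) = φ n g * φ n h

/-- `(φ_n)` is separating. -/
def IsSeparating {Γ : Type*} [Group Γ] (k : ℕ → ℕ)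
    (φ : ∀ n, Γ → Equiv.Perm (Fin (k n))) : Prop :=
  ∀ g : Γ, g ≠ 1 → Tendsto (fun n => dHam (φ n g) 1) atTop (𝓝 1)

/-- `(φ_n)` is a sequence of genuine homomorphisms. -/
def IsHomSeq {Γ : Type*} [Group Γ] (k : ℕ → ℕ)
    (φ : ∀ n, Γ → Equiv.Perm (Fin (k n))) : Prop :=
  ∀ n, ∀ g h : Γ, φ n (g * h) = φ n g * φ n h

/-- `(ψ_n)` is asymptotically close to `(φ_n)`: for every `g`, `d_{k_n}(φ_n g, ψ_n g) → 0`. -/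
def CloseSeq {Γ : Type*} [Group Γ] (k : ℕ → ℕ)
    (φ ψ : ∀ n, Γ → Equiv.Perm (Fin (k n))) : Prop :=
  ∀ g : Γ, Tendsto (fun n => dHam (φ n g) (ψ n g)) atTop (𝓝 0)

/-- `Γ` is locally stable. -/
def IsLocallyStable (Γ : Type*) [Group Γ] : Prop :=
  ∀ (k : ℕ → ℕ), (∀ n, 0 < k n) →
    ∀ φ : ∀ n, Γ → Equiv.Perm (Fin (k n)), IsAlmostHom k φ →
      ∃ ψ : ∀ n, Γ → Equiv.Perm (Fin (k n)), IsPartialHom k ψ ∧ CloseSeq k φ ψ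

/-- `Γ` is weakly locally stable. -/
def IsWeaklyLocallyStable (Γ : Type*) [Group Γ] : Prop :=
  ∀ (k : ℕ → ℕ), (∀ n, 0 < k n) →
    ∀ φ : ∀ n, Γ → Equiv.Perm (Fin (k n)), IsAlmostHom k φ → IsSeparating k φ →
      ∃ ψ : ∀ n, Γ → Equiv.Perm (Fin (k n)), IsPartialHom k ψ ∧ CloseSeq k φ ψ

/-- `Γ` is stable (in permutations). -/
def IsStable (Γ : Type*) [Group Γ] : Prop :=
  ∀ (k : ℕ → ℕ), (∀ n, 0 < k n) →
    ∀ φ : ∀ n, Γ → Equiv.Perm (Fin (k n)), IsAlmostHom k φ →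
      ∃ ψ : ∀ n, Γ → Equiv.Perm (Fin (k n)), IsHomSeq k ψ ∧ CloseSeq k φ ψ

/-- `Γ` is weakly stable. -/
def IsWeaklyStable (Γ : Type*) [Group Γ] : Prop :=
  ∀ (k : ℕ → ℕ), (∀ n, 0 < k n) →
    ∀ φ : ∀ n, Γ → Equiv.Perm (Fin (k n)), IsAlmostHom k φ → IsSeparating k φ →
      ∃ ψ : ∀ n, Γ → Equiv.Perm (Fin (k n)), IsHomSeq k ψ ∧ CloseSeq k φ ψ

/-- `Γ` is sofic: it admits a separating almost-homomorphism. -/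
def IsSofic (Γ : Type*) [Group Γ] : Prop :=
  ∃ (k : ℕ → ℕ), (∀ n, 0 < k n) ∧
    ∃ φ : ∀ n, Γ → Equiv.Perm (Fin (k n)), IsAlmostHom k φ ∧ IsSeparating k φ

/-- `Γ` is LEF: it admits a separating partial homomorphism. -/
def IsLEF (Γ : Type*) [Group Γ] : Prop :=
  ∃ (k : ℕ → ℕ), (∀ n, 0 < k n) ∧
    ∃ φ : ∀ n, Γ → Equiv.Perm (Fin (k n)), IsPartialHom k φ ∧ IsSeparating k φ

/-- `Γ` is amenable: the Følner condition. For every finite `A ⊆ Γ` and `ε > 0` there is a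
nonempty finite `F ⊆ Γ` with `|aF ∆ F| ≤ ε |F|` for every `a ∈ A`. -/
def IsAmenable (Γ : Type*) [Group Γ] : Prop :=
  ∀ (A : Finset Γ) (ε : ℝ), 0 < ε →
    ∃ F : Finset Γ, F.Nonempty ∧
      ∀ a ∈ A, ((symmDiff (F.image fun x => a * x) F).card : ℝ) ≤ ε * F.card


/-- The points at which `φ` fails to be a free action on the finite window `T`. -/
noncomputable def badSet {Γ : Type*} [Group Γ] {k : ℕ} (T : Finset Γ)
    (φ : Γ → Equiv.Perm (Fin k)) : Finset (Fin k) :=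
  Finset.univ.filter fun x =>
    ¬ ∀ g ∈ T, ∀ h ∈ T, φ g (φ h x) = φ (g * h) x ∧ (φ g x = φ h x → g = h)

/-- `φ` is a free action on the window `T` away from a proportion `δ` of the points. -/
def IsGood {Γ : Type*} [Group Γ] {k : ℕ} (T : Finset Γ) (δ : ℝ)
    (φ : Γ → Equiv.Perm (Fin k)) : Prop :=
  ((badSet T φ).card : ℝ) ≤ δ * k

lemma badSet_mono {Γ : Type*} [Group Γ] {k : ℕ} {T T' : Finset Γ} (h : T ⊆ T')
    (φ : Γ → Equiv.Perm (Fin k)) : badSet T φ ⊆ badSet T' φ := by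
  intro x hx
  simp only [badSet, Finset.mem_filter, Finset.mem_univ, true_and] at hx ⊢
  exact fun H => hx fun g hg g' hg' => H g (h hg) g' (h hg')

lemma IsGood.mono {Γ : Type*} [Group Γ] {k : ℕ} {T T' : Finset Γ} {δ δ' : ℝ} (h : T ⊆ T')
    (hδ : δ' ≤ δ) {φ : Γ → Equiv.Perm (Fin k)} (hφ : IsGood T' δ' φ) : IsGood T δ φ := by
  have h1 : ((badSet T φ).card : ℝ) ≤ (badSet T' φ).card := by
    exact_mod_cast Finset.card_le_card (badSet_mono h φ)
  have h2 : δ' * (k : ℝ) ≤ δ * k := by gcongr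
  unfold IsGood at *
  linarith

lemma mul_apply_of_notMem_badSet {Γ : Type*} [Group Γ] {k : ℕ} {T : Finset Γ}
    {φ : Γ → Equiv.Perm (Fin k)} {x : Fin k} (hx : x ∉ badSet T φ) {g h : Γ} (hg : g ∈ T)
    (hh : h ∈ T) : φ g (φ h x) = φ (g * h) x := by
  simp only [badSet, Finset.mem_filter, Finset.mem_univ, true_and, not_not] at hx
  exact (hx g hg h hh).1

lemma eq_of_notMem_badSet {Γ : Type*} [Group Γ] {k : ℕ} {T : Finset Γ}
    {φ : Γ → Equiv.Perm (Fin k)} {x : Fin k} (hx : x ∉ badSet T φ) {g h : Γ} (hg : g ∈ T)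
    (hh : h ∈ T) (hgh : φ g x = φ h x) : g = h := by
  simp only [badSet, Finset.mem_filter, Finset.mem_univ, true_and, not_not] at hx
  exact (hx g hg h hh).2 hgh

/-- The points outside `U` that `φ g` moves into `U`. -/
def entering {Γ : Type*} {k : ℕ} (φ : Γ → Equiv.Perm (Fin k)) (U : Finset (Fin k)) (g : Γ) :
    Finset (Fin k) :=
  Finset.univ.filter fun z => z ∉ U ∧ φ g z ∈ U

/-- The tile `F x`. -/
def tile {Γ : Type*} {k : ℕ} (φ : Γ → Equiv.Perm (Fin k)) (F : Finset Γ) (x : Fin k) :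
    Finset (Fin k) :=
  F.image fun f => φ f x

/-- `F` is Følner with respect to `K`, with constant `η`. -/
def IsFolner {Γ : Type*} [Group Γ] (K F : Finset Γ) (η : ℝ) : Prop :=
  ∀ g ∈ K, ((F.filter fun f => g * f ∉ F).card : ℝ) ≤ η * F.card ∧
    ((F.filter fun f => g⁻¹ * f ∉ F).card : ℝ) ≤ η * F.card

lemma IsAmenable.exists_isFolner {Γ : Type*} [Group Γ] (h : IsAmenable Γ) (K : Finset Γ)
    {η : ℝ} (hη : 0 < η) : ∃ F : Finset Γ, F.Nonempty ∧ IsFolner K F η := by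
  obtain ⟨F, hF, hFK⟩ := h K η hη
  refine ⟨F, hF, fun g hg => ⟨le_trans ?_ (hFK g hg), le_trans ?_ (hFK g hg)⟩⟩
  · norm_cast
    refine Finset.card_le_card_of_injOn (fun f => g * f) ?_ (fun a _ b _ hab => by simpa using hab)
    intro f hf
    have hf' := Finset.mem_filter.1 hf
    exact Finset.mem_coe.2 (Finset.mem_symmDiff.2
      (Or.inl ⟨Finset.mem_image_of_mem _ hf'.1, hf'.2⟩))
  · norm_cast
    refine Finset.card_le_card ?_
    intro f hf
    simp only [Finset.mem_filter] at hf
    rw [Finset.mem_symmDiff]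
    refine Or.inr ⟨hf.1, fun h' => hf.2 ?_⟩
    obtain ⟨a, ha, rfl⟩ := Finset.mem_image.1 h'
    simpa using ha

lemma card_entering_union_tile_le {Γ : Type*} [Group Γ] {k : ℕ} {φ : Γ → Equiv.Perm (Fin k)}
    {T F : Finset Γ} {x : Fin k} (hx : x ∉ badSet T φ) (hF : F ⊆ T) {g : Γ} (hg : g ∈ T)
    (U : Finset (Fin k)) :
    (entering φ (U ∪ tile φ F x) g).card
      ≤ (entering φ U g).card + (F.filter fun f => g⁻¹ * f ∉ F).card := by
  have : entering φ (U ∪ tile φ F x) g ⊆ entering φ U g ∪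
      (F.filter fun f => g⁻¹ * f ∉ F).image (fun f => (φ g)⁻¹ (φ f x)) := by
    intro z hz
    simp only [entering, tile, Finset.mem_filter, Finset.mem_univ, true_and, Finset.mem_union,
      Finset.mem_image, not_or] at hz ⊢
    obtain ⟨⟨hzU, hzF⟩, h | ⟨f, hf, hfz⟩⟩ := hz
    · exact Or.inl ⟨hzU, h⟩
    · refine Or.inr ⟨f, ⟨hf, fun hgf => hzF ⟨g⁻¹ * f, hgf, ?_⟩⟩, ?_⟩
      · have := mul_apply_of_notMem_badSet hx hg (hF hgf)
        rw [mul_inv_cancel_left, hfz] at this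
        exact (φ g).injective this
      · rw [hfz]; simp
  refine (Finset.card_le_card this).trans ((Finset.card_union_le _ _).trans ?_)
  gcongr
  exact Finset.card_image_le

/-- A partial matching `M` between quasi-tiled regions `U`, `V` of `φ`, `ψ`, of total tile
weight `w`; `K`, `η` measure the invariance of the regions and `S`, `ε` the equivariance of the
matching. -/
structure IsMatching {Γ : Type*} [Group Γ] {k : ℕ} (φ ψ : Γ → Equiv.Perm (Fin k))
    (S : Finset Γ) (ε : ℝ) (K : Finset Γ) (η : ℝ) (U V : Finset (Fin k))
    (M : Finset (Fin k × Fin k)) (w : ℕ) : Prop where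
  fst_mem : ∀ p ∈ M, p.1 ∈ U
  snd_mem : ∀ p ∈ M, p.2 ∈ V
  fst_eq_iff : ∀ p ∈ M, ∀ q ∈ M, p.1 = q.1 ↔ p.2 = q.2
  card_left : U.card ≤ w
  card_right : V.card ≤ w
  le_card : (1 - 2 * ε) * w ≤ M.card
  defect : ∀ s ∈ S, ((M.filter fun p => (φ s p.1, ψ s p.2) ∉ M).card : ℝ) ≤ 3 * ε * w
  entering_left : ∀ g ∈ K, ((entering φ U g).card : ℝ) ≤ η * w
  entering_right : ∀ g ∈ K, ((entering ψ V g).card : ℝ) ≤ η * w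

lemma IsMatching.mono {Γ : Type*} [Group Γ] {k : ℕ} {φ ψ : Γ → Equiv.Perm (Fin k)}
    {S : Finset Γ} {ε : ℝ} {K K' : Finset Γ} {η η' : ℝ} {U V : Finset (Fin k)}
    {M : Finset (Fin k × Fin k)} {w : ℕ} (h : IsMatching φ ψ S ε K' η' U V M w) (hK : K ⊆ K')
    (hη : η' ≤ η) : IsMatching φ ψ S ε K η U V M w :=
  { h with
    entering_left := fun g hg => (h.entering_left g (hK hg)).trans (by gcongr)
    entering_right := fun g hg => (h.entering_right g (hK hg)).trans (by gcongr) }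

lemma IsMatching.empty {Γ : Type*} [Group Γ] {k : ℕ} (φ ψ : Γ → Equiv.Perm (Fin k))
    (S : Finset Γ) (ε : ℝ) (K : Finset Γ) (η : ℝ) : IsMatching φ ψ S ε K η ∅ ∅ ∅ 0 := by
  constructor <;> simp [entering]

/-- Adjoining one pair of tiles to a partial matching. -/
lemma IsMatching.exists_insert_tile {Γ : Type*} [Group Γ] {k : ℕ} {φ ψ : Γ → Equiv.Perm (Fin k)}
    {S : Finset Γ} {ε : ℝ} {K : Finset Γ} {η : ℝ} {U V : Finset (Fin k)}
    {M : Finset (Fin k × Fin k)} {w : ℕ} (h : IsMatching φ ψ S ε K η U V M w)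
    {T F : Finset Γ} (hFT : F ⊆ T) (hKT : K ⊆ T) (hST : S ⊆ T) (hFK : IsFolner K F η)
    (hFS : IsFolner S F ε) {x y : Fin k} (hx : x ∉ badSet T φ) (hy : y ∉ badSet T ψ)
    (hxU : ((F.filter fun f => φ f x ∈ U).card : ℝ) ≤ ε * F.card)
    (hyV : ((F.filter fun f => ψ f y ∈ V).card : ℝ) ≤ ε * F.card) :
    ∃ M', IsMatching φ ψ S ε K η (U ∪ tile φ F x) (V ∪ tile ψ F y) M' (w + F.card) := by
  set A := F.filter fun f => φ f x ∈ U with hA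
  set B := F.filter fun f => ψ f y ∈ V with hB
  set N := F.filter fun f => φ f x ∉ U ∧ ψ f y ∉ V with hN
  have hNF : N ⊆ F := Finset.filter_subset _ _
  have hFN : F ⊆ N ∪ (A ∪ B) := by
    intro f hf
    simp only [hA, hB, hN, Finset.mem_union, Finset.mem_filter, hf, true_and]
    tauto
  have hcard : (F.card : ℝ) ≤ N.card + (A.card + B.card) := by
    have h1 := Finset.card_le_card hFN
    have h2 := Finset.card_union_le N (A ∪ B)
    have h3 := Finset.card_union_le A B
    exact_mod_cast (by omega : F.card ≤ N.card + (A.card + B.card))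
  set P := N.image fun f => (φ f x, ψ f y) with hP
  have hPcard : P.card = N.card := by
    apply Finset.card_image_of_injOn
    intro a ha b hb hab
    exact eq_of_notMem_badSet hx (hFT (hNF ha)) (hFT (hNF hb)) (Prod.ext_iff.1 hab).1
  have hdisj : Disjoint M P := by
    rw [Finset.disjoint_left]
    intro p hp hpP
    obtain ⟨f, hf, rfl⟩ := Finset.mem_image.1 hpP
    exact (Finset.mem_filter.1 hf).2.1 (h.fst_mem _ hp)
  have htile : ∀ (χ : Γ → Equiv.Perm (Fin k)) (z : Fin k), (tile χ F z).card ≤ F.card :=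
    fun _ _ => Finset.card_image_le
  refine ⟨M ∪ P, ?_, ?_, ?_, ?_, ?_, ?_, ?_, ?_, ?_⟩
  · intro p hp
    rcases Finset.mem_union.1 hp with hp | hp
    · exact Finset.mem_union_left _ (h.fst_mem p hp)
    · obtain ⟨f, hf, rfl⟩ := Finset.mem_image.1 hp
      exact Finset.mem_union_right _ (Finset.mem_image_of_mem _ (hNF hf))
  · intro p hp
    rcases Finset.mem_union.1 hp with hp | hp
    · exact Finset.mem_union_left _ (h.snd_mem p hp)
    · obtain ⟨f, hf, rfl⟩ := Finset.mem_image.1 hp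
      exact Finset.mem_union_right _ (Finset.mem_image_of_mem _ (hNF hf))
  · have key : ∀ p ∈ M, ∀ f ∈ N, p.1 ≠ φ f x ∧ p.2 ≠ ψ f y := by
      intro p hp f hf
      have := (Finset.mem_filter.1 hf).2
      exact ⟨fun e => this.1 (e ▸ h.fst_mem p hp), fun e => this.2 (e ▸ h.snd_mem p hp)⟩
    intro p hp q hq
    rcases Finset.mem_union.1 hp with hp | hp <;> rcases Finset.mem_union.1 hq with hq | hq
    · exact h.fst_eq_iff p hp q hq
    · obtain ⟨f, hf, rfl⟩ := Finset.mem_image.1 hq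
      have := key p hp f hf
      simp [this.1, this.2]
    · obtain ⟨f, hf, rfl⟩ := Finset.mem_image.1 hp
      have := key q hq f hf
      simp [this.1.symm, this.2.symm]
    · obtain ⟨f, hf, rfl⟩ := Finset.mem_image.1 hp
      obtain ⟨f', hf', rfl⟩ := Finset.mem_image.1 hq
      constructor
      · intro e
        rw [eq_of_notMem_badSet hx (hFT (hNF hf)) (hFT (hNF hf')) e]
      · intro e
        rw [eq_of_notMem_badSet hy (hFT (hNF hf)) (hFT (hNF hf')) e]
  · exact (Finset.card_union_le _ _).trans (add_le_add h.card_left (htile _ _))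
  · exact (Finset.card_union_le _ _).trans (add_le_add h.card_right (htile _ _))
  · rw [Finset.card_union_of_disjoint hdisj, hPcard]
    have := h.le_card
    push_cast
    linarith
  · intro s hs
    have hsub : ((M ∪ P).filter fun p => (φ s p.1, ψ s p.2) ∉ M ∪ P) ⊆
        (M.filter fun p => (φ s p.1, ψ s p.2) ∉ M) ∪
          (((F.filter fun f => s * f ∉ F) ∪
            (F.filter fun f => s * f ∈ A ∪ B)).image fun f => (φ f x, ψ f y)) := by
      intro p hp
      rw [Finset.mem_filter, Finset.mem_union] at hp
      obtain ⟨hp | hp, hpn⟩ := hp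
      · refine Finset.mem_union_left _ (Finset.mem_filter.2 ⟨hp, fun h' => hpn ?_⟩)
        exact Finset.mem_union_left _ h'
      · refine Finset.mem_union_right _ ?_
        obtain ⟨f, hf, rfl⟩ := Finset.mem_image.1 hp
        refine Finset.mem_image_of_mem _ ?_
        rw [Finset.mem_union, Finset.mem_filter, Finset.mem_filter]
        by_cases hsf : s * f ∈ F
        · refine Or.inr ⟨hNF hf, ?_⟩
          rcases Finset.mem_union.1 (hFN hsf) with h' | h'
          · exfalso
            apply hpn
            refine Finset.mem_union_right _ (Finset.mem_image.2 ⟨s * f, h', ?_⟩)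
            rw [mul_apply_of_notMem_badSet hx (hST hs) (hFT (hNF hf)),
              mul_apply_of_notMem_badSet hy (hST hs) (hFT (hNF hf))]
          · exact h'
        · exact Or.inl ⟨hNF hf, hsf⟩
    have h1 := Finset.card_le_card hsub
    have h2 := Finset.card_union_le (M.filter fun p => (φ s p.1, ψ s p.2) ∉ M)
      (((F.filter fun f => s * f ∉ F) ∪
            (F.filter fun f => s * f ∈ A ∪ B)).image fun f => (φ f x, ψ f y))
    have h3 : (((F.filter fun f => s * f ∉ F) ∪
        (F.filter fun f => s * f ∈ A ∪ B)).image fun f => (φ f x, ψ f y)).card ≤ _ :=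
      Finset.card_image_le
    have h4 := Finset.card_union_le (F.filter fun f => s * f ∉ F)
      (F.filter fun f => s * f ∈ A ∪ B)
    have h5 : (F.filter fun f => s * f ∈ A ∪ B).card ≤ (A ∪ B).card :=
      Finset.card_le_card_of_injOn (fun f => s * f) (fun f hf => (Finset.mem_filter.1 hf).2)
        (fun a _ b _ hab => by simpa using hab)
    have h6 := Finset.card_union_le A B
    have h7 : (((M ∪ P).filter fun p => (φ s p.1, ψ s p.2) ∉ M ∪ P).card : ℝ) ≤
        (M.filter fun p => (φ s p.1, ψ s p.2) ∉ M).card +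
          ((F.filter fun f => s * f ∉ F).card + (A.card + B.card)) := by
      exact_mod_cast (by omega)
    have h8 := h.defect s hs
    have h9 := (hFS s hs).1
    push_cast
    linarith
  · intro g hg
    have h1 : ((entering φ (U ∪ tile φ F x) g).card : ℝ) ≤ _ :=
      Nat.cast_le.2 (card_entering_union_tile_le hx hFT (hKT hg) U)
    have h2 := h.entering_left g hg
    have h3 := (hFK g hg).2
    push_cast at h1 ⊢
    linarith
  · intro g hg
    have h1 : ((entering ψ (V ∪ tile ψ F y) g).card : ℝ) ≤ _ :=
      Nat.cast_le.2 (card_entering_union_tile_le hy hFT (hKT hg) V)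
    have h2 := h.entering_right g hg
    have h3 := (hFK g hg).2
    push_cast at h1 ⊢
    linarith

/-- If `U` is not much larger than the `F`-invariant set `U₀`, some good tile `F x` is nearly
disjoint from `U`. -/
lemma exists_tile_nearly_disjoint {Γ : Type*} [Group Γ] {k : ℕ} (hk : 0 < k)
    {φ : Γ → Equiv.Perm (Fin k)} {T F : Finset Γ} (hF : F.Nonempty) {ε : ℝ} (hε : 0 < ε)
    {U₀ U : Finset (Fin k)} (hgood : IsGood T (ε / 4) φ) (hU₀ : ε * k ≤ ((U₀ᶜ).card : ℝ))
    (hent : ∀ g ∈ F, ((entering φ U₀ g).card : ℝ) ≤ ε / 4 * k / F.card)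
    (hU : ((U \ U₀).card : ℝ) < ε ^ 2 / 2 * k) :
    ∃ x, x ∉ badSet T φ ∧ ((F.filter fun f => φ f x ∈ U).card : ℝ) ≤ ε * F.card := by
  by_contra! H
  set E := F.biUnion fun g => entering φ U₀ g with hE
  set G := U₀ᶜ \ (badSet T φ ∪ E) with hG
  have hFpos : (0 : ℝ) < F.card := by exact_mod_cast hF.card_pos
  have hkpos : (0 : ℝ) < k := by exact_mod_cast hk
  have hEcard : (E.card : ℝ) ≤ ε / 4 * k := by
    have h1 : (E.card : ℝ) ≤ ∑ g ∈ F, ((entering φ U₀ g).card : ℝ) := by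
      exact_mod_cast Finset.card_biUnion_le
    have h2 := Finset.sum_le_sum hent
    rw [Finset.sum_const, nsmul_eq_mul, mul_div_cancel₀ _ hFpos.ne'] at h2
    exact h1.trans h2
  have hGcard : ε / 2 * k ≤ G.card := by
    have h1 : U₀ᶜ.card ≤ G.card + ((badSet T φ).card + E.card) := by
      have := Finset.card_le_card (show U₀ᶜ ⊆ G ∪ (badSet T φ ∪ E) by
        rw [hG, Finset.sdiff_union_self_eq_union]; exact Finset.subset_union_left)
      have := Finset.card_union_le G (badSet T φ ∪ E)
      have := Finset.card_union_le (badSet T φ) E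
      omega
    have h2 : ((U₀ᶜ).card : ℝ) ≤ G.card + ((badSet T φ).card + E.card) := by exact_mod_cast h1
    have h3 : ((badSet T φ).card : ℝ) ≤ ε / 4 * k := hgood
    linarith
  have hlow : ∀ x ∈ G, ε * F.card ≤ ((F.filter fun f => φ f x ∈ U \ U₀).card : ℝ) := by
    intro x hx
    simp only [hG, hE, Finset.mem_sdiff, Finset.mem_compl, Finset.mem_union, not_or,
      Finset.mem_biUnion, not_exists, not_and, entering, Finset.mem_filter, Finset.mem_univ,
      true_and] at hx
    refine (H x hx.2.1).le.trans (Nat.cast_le.2 (Finset.card_le_card ?_))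
    intro f hf
    rw [Finset.mem_filter] at hf ⊢
    exact ⟨hf.1, Finset.mem_sdiff.2 ⟨hf.2, hx.2.2 f hf.1 hx.1⟩⟩
  have hcount : ∑ x ∈ G, (F.filter fun f => φ f x ∈ U \ U₀).card ≤ F.card * (U \ U₀).card := by
    rw [show ∑ x ∈ G, (F.filter fun f => φ f x ∈ U \ U₀).card
        = ∑ f ∈ F, (G.filter fun x => φ f x ∈ U \ U₀).card from
      Finset.sum_card_bipartiteAbove_eq_sum_card_bipartiteBelow fun x f => φ f x ∈ U \ U₀]
    rw [← smul_eq_mul]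
    refine Finset.sum_le_card_nsmul _ _ _ fun f _ => ?_
    exact Finset.card_le_card_of_injOn (φ f) (fun x hx => (Finset.mem_filter.1 hx).2)
      (φ f).injective.injOn
  have hsum : (G.card : ℝ) * (ε * F.card) ≤ F.card * (U \ U₀).card := by
    have h1 := Finset.card_nsmul_le_sum G _ _ hlow
    rw [nsmul_eq_mul] at h1
    exact h1.trans (by exact_mod_cast hcount)
  have h1 : ε * (G.card : ℝ) ≤ (U \ U₀).card := by
    refine le_of_mul_le_mul_left ?_ hFpos
    linarith
  have h2 : ε * (ε / 2 * k) ≤ ε * G.card := by gcongr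
  nlinarith

lemma IsMatching.weight_le {Γ : Type*} [Group Γ] {k : ℕ} {φ ψ : Γ → Equiv.Perm (Fin k)}
    {S : Finset Γ} {ε : ℝ} {K : Finset Γ} {η : ℝ} {U V : Finset (Fin k)}
    {M : Finset (Fin k × Fin k)} {w : ℕ} (h : IsMatching φ ψ S ε K η U V M w) (hε : ε ≤ 1 / 4) :
    (w : ℝ) ≤ 2 * k := by
  have h1 : M.card ≤ k := by
    have : M.card ≤ (Finset.univ : Finset (Fin k)).card :=
      Finset.card_le_card_of_injOn Prod.fst (fun _ _ => by simp)
        (fun p hp q hq e => Prod.ext e ((h.fst_eq_iff p hp q hq).1 e))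
    simpa using this
  have h2 : (M.card : ℝ) ≤ k := by exact_mod_cast h1
  have h3 := h.le_card
  have h4 : (0 : ℝ) ≤ w := by positivity
  nlinarith

/-- One scale of the greedy quasi-tiling. -/
lemma IsMatching.exists_scale {Γ : Type*} [Group Γ] {k : ℕ} (hk : 0 < k)
    {φ ψ : Γ → Equiv.Perm (Fin k)} {S : Finset Γ} {ε : ℝ} (hε : 0 < ε) (hε' : ε ≤ 1 / 4)
    {K F : Finset Γ} {η : ℝ} (hF : F.Nonempty) (hFK : IsFolner K F η) (hFS : IsFolner S F ε)
    {T : Finset Γ} (hFT : F ⊆ T) (hKT : K ⊆ T) (hST : S ⊆ T)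
    (hφ : IsGood T (ε / 4) φ) (hψ : IsGood T (ε / 4) ψ) {η' : ℝ} (hη : η' ≤ η) (hη'0 : 0 ≤ η')
    (hη' : η' ≤ ε / (8 * F.card)) {U₀ V₀ : Finset (Fin k)} {M₀ : Finset (Fin k × Fin k)} {w₀ : ℕ}
    (h : IsMatching φ ψ S ε (K ∪ F) η' U₀ V₀ M₀ w₀)
    (hU₀ : ε * k ≤ ((U₀ᶜ).card : ℝ)) (hV₀ : ε * k ≤ ((V₀ᶜ).card : ℝ)) :
    ∃ U V M w, IsMatching φ ψ S ε K η U V M w ∧ w₀ + ε ^ 2 / 2 * k ≤ w := by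
  have hFpos : (0 : ℝ) < F.card := by exact_mod_cast hF.card_pos
  have hbound : η' * (w₀ : ℝ) ≤ ε / 4 * k / F.card := by
    calc η' * (w₀ : ℝ) ≤ η' * (2 * k) := by gcongr; exact h.weight_le hε'
      _ ≤ ε / (8 * F.card) * (2 * k) := by gcongr
      _ = ε / 4 * k / F.card := by field_simp; ring
  have key : ∀ n : ℕ, ∃ U V M w, IsMatching φ ψ S ε K η U V M w ∧
      (U \ U₀).card + w₀ ≤ w ∧ (V \ V₀).card + w₀ ≤ w ∧
      (w₀ + n ≤ w ∨ w₀ + ε ^ 2 / 2 * k ≤ w) := by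
    intro n
    induction n with
    | zero =>
      exact ⟨U₀, V₀, M₀, w₀, h.mono Finset.subset_union_left hη, by simp, by simp, by simp⟩
    | succ n ih =>
      obtain ⟨U, V, M, w, hM, hU, hV, hw⟩ := ih
      by_cases hdone : (w₀ : ℝ) + ε ^ 2 / 2 * k ≤ w
      · exact ⟨U, V, M, w, hM, hU, hV, Or.inr hdone⟩
      have hw' := hw.resolve_right hdone
      have hU' : ((U \ U₀).card : ℝ) + w₀ ≤ w := by exact_mod_cast hU
      have hV' : ((V \ V₀).card : ℝ) + w₀ ≤ w := by exact_mod_cast hV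
      push Not at hdone
      obtain ⟨x, hx, hxU⟩ := exists_tile_nearly_disjoint (U := U) hk hF hε hφ hU₀
        (fun g hg => (h.entering_left g (Finset.mem_union_right _ hg)).trans hbound)
        (by linarith)
      obtain ⟨y, hy, hyV⟩ := exists_tile_nearly_disjoint (U := V) hk hF hε hψ hV₀
        (fun g hg => (h.entering_right g (Finset.mem_union_right _ hg)).trans hbound)
        (by linarith)
      obtain ⟨M', hM'⟩ := hM.exists_insert_tile hFT hKT hST hFK hFS hx hy hxU hyV
      have hgrow : ∀ (χ : Γ → Equiv.Perm (Fin k)) (z : Fin k) (W W₀ : Finset (Fin k)),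
          ((W ∪ tile χ F z) \ W₀).card ≤ (W \ W₀).card + F.card := by
        intro χ z W W₀
        rw [Finset.union_sdiff_distrib]
        refine (Finset.card_union_le _ _).trans ?_
        gcongr
        exact (Finset.card_le_card Finset.sdiff_subset).trans Finset.card_image_le
      have h1 := hgrow φ x U U₀
      have h2 := hgrow ψ y V V₀
      have h3 := hF.card_pos
      exact ⟨_, _, M', _, hM', by omega, by omega, Or.inl (by omega)⟩
  obtain ⟨U, V, M, w, hM, -, -, hw⟩ := key ⌈ε ^ 2 / 2 * k⌉₊
  refine ⟨U, V, M, w, hM, ?_⟩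
  rcases hw with hw | hw
  · have h1 := Nat.le_ceil (ε ^ 2 / 2 * (k : ℝ))
    have h2 : (w₀ : ℝ) + (⌈ε ^ 2 / 2 * (k : ℝ)⌉₊ : ℝ) ≤ w := by exact_mod_cast hw
    linarith
  · exact hw

/-- After `N` scales, the matching is either nearly full or of weight at least `N ε² k / 2`. -/
lemma IsAmenable.exists_isMatching {Γ : Type*} [Group Γ] (ham : IsAmenable Γ) (S : Finset Γ)
    {ε : ℝ} (hε : 0 < ε) (hε' : ε ≤ 1 / 4) (N : ℕ) :
    ∀ (K : Finset Γ) (η : ℝ), 0 < η → ∃ (T : Finset Γ) (δ : ℝ), 0 < δ ∧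
      ∀ (k : ℕ), 0 < k → ∀ φ ψ : Γ → Equiv.Perm (Fin k), IsGood T δ φ → IsGood T δ ψ →
        ∃ U V M w, IsMatching φ ψ S ε K η U V M w ∧
          (((U ᶜ).card : ℝ) < ε * k ∨ ((V ᶜ).card : ℝ) < ε * k ∨ N * (ε ^ 2 / 2 * k) ≤ w) := by
  induction N with
  | zero =>
    intro K η hη
    refine ⟨∅, 1, one_pos, fun k hk φ ψ _ _ => ⟨∅, ∅, ∅, 0, IsMatching.empty φ ψ S ε K η, ?_⟩⟩
    simp
  | succ N ih =>
    intro K η hη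
    obtain ⟨F, hF, hFol⟩ := ham.exists_isFolner (K ∪ S) (lt_min hη hε)
    have hFK : IsFolner K F η := fun g hg =>
      ⟨(hFol g (Finset.mem_union_left _ hg)).1.trans (by gcongr; exact min_le_left _ _),
        (hFol g (Finset.mem_union_left _ hg)).2.trans (by gcongr; exact min_le_left _ _)⟩
    have hFS : IsFolner S F ε := fun g hg =>
      ⟨(hFol g (Finset.mem_union_right _ hg)).1.trans (by gcongr; exact min_le_right _ _),
        (hFol g (Finset.mem_union_right _ hg)).2.trans (by gcongr; exact min_le_right _ _)⟩
    have hFpos : (0 : ℝ) < F.card := by exact_mod_cast hF.card_pos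
    have hη' : 0 < min η (ε / (8 * F.card)) := lt_min hη (by positivity)
    obtain ⟨T, δ, hδ, hT⟩ := ih (K ∪ F) _ hη'
    refine ⟨T ∪ (F ∪ K ∪ S), min δ (ε / 4), lt_min hδ (by positivity), ?_⟩
    intro k hk φ ψ hφ hψ
    obtain ⟨U, V, M, w, hM, hw⟩ := hT k hk φ ψ
      (hφ.mono Finset.subset_union_left (min_le_left _ _))
      (hψ.mono Finset.subset_union_left (min_le_left _ _))
    by_cases hU : ((U ᶜ).card : ℝ) < ε * k
    · exact ⟨U, V, M, w, hM.mono Finset.subset_union_left (min_le_left _ _), Or.inl hU⟩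
    by_cases hV : ((V ᶜ).card : ℝ) < ε * k
    · exact ⟨U, V, M, w, hM.mono Finset.subset_union_left (min_le_left _ _), Or.inr (Or.inl hV)⟩
    have hw' := (hw.resolve_left hU).resolve_left hV
    obtain ⟨U', V', M', w', hM', hw''⟩ := hM.exists_scale hk hε hε' hF hFK hFS
      (T := F ∪ K ∪ S) (by grind) (by grind) (by grind)
      (hφ.mono Finset.subset_union_right (min_le_right _ _))
      (hψ.mono Finset.subset_union_right (min_le_right _ _)) (min_le_left _ _) hη'.le
      (min_le_right _ _) (not_lt.1 hU) (not_lt.1 hV)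
    refine ⟨U', V', M', w', hM', Or.inr (Or.inr ?_)⟩
    push_cast
    linarith

/-- An injective partial matching extends to a permutation. -/
lemma exists_perm_of_matching {k : ℕ} {M : Finset (Fin k × Fin k)}
    (hM : ∀ p ∈ M, ∀ q ∈ M, p.1 = q.1 ↔ p.2 = q.2) :
    ∃ f : Equiv.Perm (Fin k), ∀ p ∈ M, f p.1 = p.2 := by
  let F : Fin k → Fin k := fun x => if h : ∃ y, (x, y) ∈ M then h.choose else x
  have hF : ∀ p ∈ M, F p.1 = p.2 := by
    intro p hp
    have h : ∃ y, (p.1, y) ∈ M := ⟨p.2, hp⟩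
    simp only [F, dif_pos h]
    exact (hM _ h.choose_spec p hp).1 rfl
  obtain ⟨g, hg⟩ := Finset.exists_equiv_extend_of_card_eq (t := (Finset.univ : Finset (Fin k)))
    (s := M.image Prod.fst) (f := F) (by simp) (by simp) (by
      intro a ha b hb e
      obtain ⟨p, hp, rfl⟩ := Finset.mem_image.1 (Finset.mem_coe.1 ha)
      obtain ⟨q, hq, rfl⟩ := Finset.mem_image.1 (Finset.mem_coe.1 hb)
      rw [hF p hp, hF q hq] at e
      exact (hM p hp q hq).2 e)
  refine ⟨g.trans (Equiv.subtypeUnivEquiv Finset.mem_univ), fun p hp => ?_⟩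
  rw [← hF p hp, ← hg p.1 (Finset.mem_image_of_mem _ hp)]
  rfl

/-- Sufficiently good sofic approximations of an amenable group on the same set are almost
conjugate. -/
theorem IsAmenable.exists_almost_conj {Γ : Type*} [Group Γ] (ham : IsAmenable Γ) (S : Finset Γ)
    {ε : ℝ} (hε : 0 < ε) :
    ∃ (T : Finset Γ) (δ : ℝ), 0 < δ ∧
      ∀ (k : ℕ), 0 < k → ∀ φ ψ : Γ → Equiv.Perm (Fin k), IsGood T δ φ → IsGood T δ ψ →
        ∃ f : Equiv.Perm (Fin k), ∀ s ∈ S,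
          ((Finset.univ.filter fun x => f (φ s x) ≠ ψ s (f x)).card : ℝ) ≤ ε * k := by
  set ε₁ := min (ε / 9) (1 / 4) with hε₁
  have h0 : 0 < ε₁ := lt_min (by positivity) (by norm_num)
  have h14 : ε₁ ≤ 1 / 4 := min_le_right _ _
  have h9 : ε₁ ≤ ε / 9 := min_le_left _ _
  obtain ⟨N, hN⟩ := exists_nat_gt (2 / (ε₁ ^ 2 / 2))
  rw [div_lt_iff₀ (by positivity)] at hN
  obtain ⟨T, δ, hδ, hT⟩ := ham.exists_isMatching S h0 h14 N ∅ 1 one_pos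
  refine ⟨T, δ, hδ, fun k hk φ ψ hφ hψ => ?_⟩
  obtain ⟨U, V, M, w, hM, hw⟩ := hT k hk φ ψ hφ hψ
  have hkpos : (0 : ℝ) < k := by exact_mod_cast hk
  have hw2 := hM.weight_le h14
  have hcompl : ∀ W : Finset (Fin k), ((W ᶜ).card : ℝ) = k - W.card := by
    intro W
    rw [Finset.card_compl, Nat.cast_sub (Finset.card_le_univ W), Fintype.card_fin]
  have hUw : (U.card : ℝ) ≤ w := by exact_mod_cast hM.card_left
  have hVw : (V.card : ℝ) ≤ w := by exact_mod_cast hM.card_right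
  have hw1 : (1 - ε₁) * k ≤ w := by
    rcases hw with hw | hw | hw
    · rw [hcompl] at hw; linarith
    · rw [hcompl] at hw; linarith
    · nlinarith
  have hMcard : (1 - 3 * ε₁) * k ≤ M.card := by
    have := hM.le_card
    nlinarith
  obtain ⟨f, hf⟩ := exists_perm_of_matching hM.fst_eq_iff
  refine ⟨f, fun s hs => ?_⟩
  have hsub : (Finset.univ.filter fun x => f (φ s x) ≠ ψ s (f x)) ⊆
      (M.image Prod.fst)ᶜ ∪ (M.filter fun p => (φ s p.1, ψ s p.2) ∉ M).image Prod.fst := by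
    intro x hx
    rw [Finset.mem_union, Finset.mem_compl]
    by_contra! H
    obtain ⟨p, hp, rfl⟩ := Finset.mem_image.1 H.1
    have hp' : (φ s p.1, ψ s p.2) ∈ M := by
      by_contra hn
      exact H.2 (Finset.mem_image_of_mem _ (Finset.mem_filter.2 ⟨hp, hn⟩))
    refine (Finset.mem_filter.1 hx).2 ?_
    rw [hf p hp]
    exact hf _ hp'
  have hcard : (M.image Prod.fst).card = M.card :=
    Finset.card_image_of_injOn fun p hp q hq e => Prod.ext e ((hM.fst_eq_iff p hp q hq).1 e)
  have h1 : ((Finset.univ.filter fun x => f (φ s x) ≠ ψ s (f x)).card : ℝ) ≤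
      ((M.image Prod.fst)ᶜ.card : ℝ) + (M.filter fun p => (φ s p.1, ψ s p.2) ∉ M).card := by
    exact_mod_cast (Finset.card_le_card hsub).trans ((Finset.card_union_le _ _).trans
      (add_le_add_right Finset.card_image_le _))
  have h2 := hM.defect s hs
  rw [hcompl, hcard] at h1
  have h3 : 3 * ε₁ * (w : ℝ) ≤ 3 * ε₁ * (2 * k) := by gcongr
  have h4 : ε₁ * k ≤ ε / 9 * k := by gcongr
  linarith

lemma dHam_self {k : ℕ} (σ : Equiv.Perm (Fin k)) : dHam σ σ = 0 := by simp [dHam]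

lemma dHam_nonneg {k : ℕ} (σ τ : Equiv.Perm (Fin k)) : 0 ≤ dHam σ τ := by
  unfold dHam; positivity

lemma dHam_le_one {k : ℕ} (σ τ : Equiv.Perm (Fin k)) : dHam σ τ ≤ 1 := by
  unfold dHam
  refine div_le_one_of_le₀ ?_ (by positivity)
  exact_mod_cast (Finset.card_le_univ _).trans_eq (Fintype.card_fin k)

lemma dHam_comm {k : ℕ} (σ τ : Equiv.Perm (Fin k)) : dHam σ τ = dHam τ σ := by
  simp only [dHam, ne_comm]

lemma dHam_triangle {k : ℕ} (σ τ υ : Equiv.Perm (Fin k)) :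
    dHam σ υ ≤ dHam σ τ + dHam τ υ := by
  unfold dHam
  rw [← add_div]
  gcongr
  norm_cast
  refine (Finset.card_le_card ?_).trans (Finset.card_union_le _ _)
  intro x hx
  simp only [Finset.mem_filter, Finset.mem_univ, true_and, Finset.mem_union] at hx ⊢
  by_contra! H
  exact hx (H.1.trans H.2)

lemma card_agree_div {k : ℕ} (hk : 0 < k) (σ τ : Equiv.Perm (Fin k)) :
    ((Finset.univ.filter fun x => σ x = τ x).card : ℝ) / k = 1 - dHam σ τ := by
  have hkpos : (0 : ℝ) < k := by exact_mod_cast hk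
  have h := Finset.card_filter_add_card_filter_not (s := (Finset.univ : Finset (Fin k)))
    (fun x => σ x = τ x)
  rw [Finset.card_univ, Fintype.card_fin] at h
  have h' : ((Finset.univ.filter fun x => σ x = τ x).card : ℝ) +
      (Finset.univ.filter fun x => σ x ≠ τ x).card = k := by exact_mod_cast h
  unfold dHam
  rw [eq_sub_iff_add_eq, ← add_div, h', div_self hkpos.ne']

/-- Controls how often `φ g` and `φ h` agree. -/
noncomputable def agreeBound {Γ : Type*} [Group Γ] {k : ℕ} (φ : Γ → Equiv.Perm (Fin k))
    (g h : Γ) : ℝ :=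
  dHam (φ h⁻¹ * φ g) (φ (h⁻¹ * g)) + dHam (φ h⁻¹ * φ h) (φ (h⁻¹ * h)) +
    dHam (φ 1 * φ 1) (φ (1 * 1)) + (1 - dHam (φ (h⁻¹ * g)) 1)

lemma one_sub_dHam_le_agreeBound {Γ : Type*} [Group Γ] {k : ℕ} (hk : 0 < k)
    (φ : Γ → Equiv.Perm (Fin k)) (g h : Γ) : 1 - dHam (φ g) (φ h) ≤ agreeBound φ g h := by
  unfold agreeBound
  rw [← card_agree_div hk, ← card_agree_div hk]
  unfold dHam
  rw [← add_div, ← add_div, ← add_div]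
  gcongr
  rw [← Nat.cast_add, ← Nat.cast_add, ← Nat.cast_add, Nat.cast_le]
  refine (Finset.card_le_card ?_).trans ((Finset.card_union_le _ _).trans (add_le_add_left
    ((Finset.card_union_le _ _).trans (add_le_add_left (Finset.card_union_le _ _) _)) _))
  intro x hx
  simp only [Finset.mem_filter, Finset.mem_univ, true_and, Finset.mem_union] at hx ⊢
  simp only [Equiv.Perm.mul_apply, mul_one, inv_mul_cancel, Equiv.Perm.one_apply]
  by_contra! H
  obtain ⟨⟨⟨h1, h2⟩, h3⟩, h4⟩ := H
  rw [← h1, hx, h2] at h4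
  exact h4 ((φ 1).injective h3)

lemma eventually_isGood {Γ : Type*} [Group Γ] {k : ℕ → ℕ} (hk : ∀ n, 0 < k n)
    {φ : ∀ n, Γ → Equiv.Perm (Fin (k n))} (hφ : IsAlmostHom k φ) (hsep : IsSeparating k φ)
    (T : Finset Γ) {δ : ℝ} (hδ : 0 < δ) : ∀ᶠ n in atTop, IsGood T δ (φ n) := by
  have hlim : Tendsto (fun n => ∑ g ∈ T, ∑ h ∈ T, (dHam (φ n g * φ n h) (φ n (g * h)) +
      if g = h then 0 else agreeBound (φ n) g h)) atTop (𝓝 0) := by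
    rw [show (0 : ℝ) = ∑ g ∈ T, ∑ h ∈ T, (0 + 0) by simp]
    refine tendsto_finsetSum _ fun g _ => tendsto_finsetSum _ fun h _ => (hφ g h).add ?_
    by_cases hgh : g = h
    · simp [hgh]
    · simp only [hgh, if_false, agreeBound]
      have h1 := hsep (h⁻¹ * g) (fun e => hgh (inv_mul_eq_one.1 e).symm)
      simpa using (((hφ h⁻¹ g).add (hφ h⁻¹ h)).add (hφ 1 1)).add (h1.const_sub 1)
  filter_upwards [hlim.eventually_le_const hδ] with n hn
  have hkpos : (0 : ℝ) < k n := by exact_mod_cast hk n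
  unfold IsGood
  rw [← div_le_iff₀ hkpos]
  refine le_trans ?_ hn
  have hsub : badSet T (φ n) ⊆ T.biUnion fun g => T.biUnion fun h =>
      (Finset.univ.filter fun x => (φ n g * φ n h) x ≠ φ n (g * h) x) ∪
        if g = h then ∅ else Finset.univ.filter fun x => φ n g x = φ n h x := by
    intro x hx
    simp only [badSet, Finset.mem_filter, Finset.mem_univ, true_and] at hx
    push Not at hx
    obtain ⟨g, hg, h, hh, H⟩ := hx
    refine Finset.mem_biUnion.2 ⟨g, hg, Finset.mem_biUnion.2 ⟨h, hh, ?_⟩⟩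
    rw [Finset.mem_union]
    by_cases h1 : (φ n g * φ n h) x = φ n (g * h) x
    · obtain ⟨h2, h3⟩ := H h1
      right
      rw [if_neg h3]
      exact Finset.mem_filter.2 ⟨Finset.mem_univ _, h2⟩
    · left
      exact Finset.mem_filter.2 ⟨Finset.mem_univ _, h1⟩
  have hcard : ((badSet T (φ n)).card : ℝ) ≤ ∑ g ∈ T, ∑ h ∈ T,
      (((Finset.univ.filter fun x => (φ n g * φ n h) x ≠ φ n (g * h) x).card : ℝ) +
        ((if g = h then ∅ else Finset.univ.filter fun x => φ n g x = φ n h x :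
          Finset (Fin (k n))).card : ℝ)) := by
    exact_mod_cast (Finset.card_le_card hsub).trans (Finset.card_biUnion_le.trans
      (Finset.sum_le_sum fun g _ => Finset.card_biUnion_le.trans
        (Finset.sum_le_sum fun h _ => Finset.card_union_le _ _)))
  refine (div_le_div_of_nonneg_right hcard hkpos.le).trans ?_
  rw [Finset.sum_div]
  refine Finset.sum_le_sum fun g _ => ?_
  rw [Finset.sum_div]
  refine Finset.sum_le_sum fun h _ => ?_
  rw [add_div]
  refine add_le_add le_rfl ?_
  by_cases hgh : g = h
  · simp [hgh]
  · simp only [hgh, if_false]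
    rw [card_agree_div (hk n)]
    exact one_sub_dHam_le_agreeBound (hk n) _ _ _

lemma IsPartialHom.isAlmostHom {Γ : Type*} [Group Γ] {k : ℕ → ℕ}
    {φ : ∀ n, Γ → Equiv.Perm (Fin (k n))} (h : IsPartialHom k φ) : IsAlmostHom k φ := by
  intro g g'
  refine tendsto_const_nhds.congr' ?_
  filter_upwards [h g g'] with n hn
  rw [hn, dHam_self]

/-- The sum of `q` copies of a permutation and a trivial one, transported to `Fin k`. -/
def amplify {k₀ q r k : ℕ} (e : Fin k ≃ (Fin k₀ × Fin q) ⊕ Fin r) (σ : Equiv.Perm (Fin k₀)) :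
    Equiv.Perm (Fin k) :=
  e.trans ((Equiv.sumCongr (Equiv.prodCongr σ (Equiv.refl _)) (Equiv.refl _)).trans e.symm)

lemma amplify_mul {k₀ q r k : ℕ} (e : Fin k ≃ (Fin k₀ × Fin q) ⊕ Fin r)
    (σ τ : Equiv.Perm (Fin k₀)) : amplify e (σ * τ) = amplify e σ * amplify e τ := by
  ext x
  rcases h : e x with ⟨a, b⟩ | c <;> simp [amplify, h]

lemma amplify_apply_of_eq {k₀ q r k : ℕ} (e : Fin k ≃ (Fin k₀ × Fin q) ⊕ Fin r)
    (σ : Equiv.Perm (Fin k₀)) {x : Fin k} {a : Fin k₀} {b : Fin q} (h : e x = Sum.inl (a, b)) :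
    amplify e σ x = e.symm (Sum.inl (σ a, b)) := by
  simp [amplify, h]

lemma card_badSet_amplify_le {Γ : Type*} [Group Γ] {k₀ q r k : ℕ}
    (e : Fin k ≃ (Fin k₀ × Fin q) ⊕ Fin r) (T : Finset Γ) (θ : Γ → Equiv.Perm (Fin k₀)) :
    (badSet T fun g => amplify e (θ g)).card ≤ (badSet T θ).card * q + r := by
  have hsub : badSet T (fun g => amplify e (θ g)) ⊆
      (((badSet T θ ×ˢ (Finset.univ : Finset (Fin q))).disjSum
        (Finset.univ : Finset (Fin r))).map e.symm.toEmbedding) := by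
    intro x hx
    rw [Finset.mem_map]
    refine ⟨e x, ?_, by simp⟩
    rcases h : e x with ⟨a, b⟩ | c
    · rw [Finset.inl_mem_disjSum, Finset.mem_product]
      refine ⟨?_, Finset.mem_univ _⟩
      by_contra ha
      simp only [badSet, Finset.mem_filter, Finset.mem_univ, true_and] at hx
      refine hx fun g hg g' hg' => ⟨?_, fun hgg' => ?_⟩
      · rw [amplify_apply_of_eq e _ h, amplify_apply_of_eq e _ h,
          amplify_apply_of_eq e _ (e.apply_symm_apply _),
          mul_apply_of_notMem_badSet ha hg hg']
      · rw [amplify_apply_of_eq e _ h, amplify_apply_of_eq e _ h] at hgg'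
        have := Sum.inl_injective (e.symm.injective hgg')
        exact eq_of_notMem_badSet ha hg hg' (Prod.ext_iff.1 this).1
    · simp
  refine (Finset.card_le_card hsub).trans ?_
  simp

/-- Quantitative form of weak local stability. -/
theorem IsLEF.exists_window {Γ : Type*} [Group Γ] (hlef : IsLEF Γ) (ham : IsAmenable Γ)
    (S : Finset Γ) {ε : ℝ} (hε : 0 < ε) :
    ∃ (T : Finset Γ) (δ : ℝ), 0 < δ ∧
      ∀ (k : ℕ), 0 < k → ∀ φ : Γ → Equiv.Perm (Fin k), IsGood T δ φ →
        ∃ ψ : Γ → Equiv.Perm (Fin k), (∀ g ∈ S, ∀ h ∈ S, ψ (g * h) = ψ g * ψ h) ∧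
          ∀ g ∈ S, dHam (φ g) (ψ g) ≤ ε := by
  obtain ⟨T, δ, hδ, hT⟩ := ham.exists_almost_conj S hε
  obtain ⟨k', hk', θ', hθ', hsep'⟩ := hlef
  have hmul : ∀ᶠ n in atTop, ∀ g ∈ S, ∀ h ∈ S, θ' n (g * h) = θ' n g * θ' n h := by
    simp only [Filter.eventually_all_finset]
    exact fun g _ h _ => hθ' g h
  obtain ⟨n, hn, hgood⟩ :=
    (hmul.and (eventually_isGood hk' hθ'.isAlmostHom hsep' T (half_pos hδ))).exists
  generalize θ' n = θ at hn hgood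
  have hk₀ := hk' n
  generalize k' n = k₀ at θ hn hgood hk₀
  have hk₀pos : (0 : ℝ) < k₀ := by exact_mod_cast hk₀
  refine ⟨T ∪ S, min δ (δ / (4 * k₀)), lt_min hδ (by positivity), fun k hk φ hφ => ?_⟩
  have hkpos : (0 : ℝ) < k := by exact_mod_cast hk
  by_cases hlarge : (k₀ : ℝ) ≤ δ / 2 * k
  · have hcard : Fintype.card (Fin k) =
        Fintype.card ((Fin k₀ × Fin (k / k₀)) ⊕ Fin (k % k₀)) := by
      simp [Nat.div_add_mod]
    let e := Fintype.equivOfCardEq hcard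
    have hgood' : IsGood T δ fun g => amplify e (θ g) := by
      have h1 : ((badSet T fun g => amplify e (θ g)).card : ℝ) ≤
          (badSet T θ).card * (k / k₀ : ℕ) + (k % k₀ : ℕ) := by
        exact_mod_cast card_badSet_amplify_le e T θ
      have h2 : ((k % k₀ : ℕ) : ℝ) ≤ k₀ := by exact_mod_cast (Nat.mod_lt k hk₀).le
      have h3 : (k₀ : ℝ) * (k / k₀ : ℕ) ≤ k := by exact_mod_cast Nat.mul_div_le k k₀
      have h4 : ((badSet T θ).card : ℝ) * (k / k₀ : ℕ) ≤ δ / 2 * k₀ * (k / k₀ : ℕ) := by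
        gcongr
        exact hgood
      have h5 : δ / 2 * (k₀ * (k / k₀ : ℕ)) ≤ δ / 2 * k := by gcongr
      unfold IsGood
      linarith
    obtain ⟨f, hf⟩ := hT k hk φ _ (hφ.mono Finset.subset_union_left (min_le_left _ _)) hgood'
    refine ⟨fun g => f⁻¹ * amplify e (θ g) * f, fun g hg h hh => ?_, fun g hg => ?_⟩
    · beta_reduce
      rw [hn g hg h hh, amplify_mul]
      group
    · unfold dHam
      rw [div_le_iff₀ hkpos]
      refine le_trans (Nat.cast_le.2 (Finset.card_le_card ?_)) (hf g hg)
      intro x hx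
      refine Finset.mem_filter.2 ⟨Finset.mem_univ _, fun h => (Finset.mem_filter.1 hx).2 ?_⟩
      rw [Equiv.Perm.mul_apply, Equiv.Perm.mul_apply, ← h]
      simp
  · push Not at hlarge
    refine ⟨φ, fun g hg h hh => ?_, fun g _ => by rw [dHam_self]; exact hε.le⟩
    have hempty : badSet (T ∪ S) φ = ∅ := by
      rw [← Finset.card_eq_zero, ← Nat.lt_one_iff]
      have h1 : ((badSet (T ∪ S) φ).card : ℝ) ≤ min δ (δ / (4 * k₀)) * k := hφ
      have h2 : min δ (δ / (4 * k₀)) * k ≤ δ / (4 * k₀) * k := by gcongr; exact min_le_right _ _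
      have h3 : δ / (4 * k₀) * k < 1 := by
        rw [div_mul_eq_mul_div, div_lt_one (by positivity)]
        linarith
      exact_mod_cast (h1.trans h2).trans_lt h3
    ext1 x
    exact (mul_apply_of_notMem_badSet (T := T ∪ S) (x := x) (by simp [hempty])
      (Finset.mem_union_right _ hg) (Finset.mem_union_right _ hh)).symm

lemma exists_exhausting_finset (Γ : Type*) [Countable Γ] :
    ∃ A : ℕ → Finset Γ, ∀ g, ∀ᶠ n in atTop, g ∈ A n := by
  obtain ⟨f, hf⟩ := Countable.exists_injective_nat Γ
  refine ⟨fun n => (Finset.range n).preimage f hf.injOn, fun g => ?_⟩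
  filter_upwards [eventually_gt_atTop (f g)] with n hn
  simpa using hn

theorem IsLEF.isWeaklyLocallyStable {Γ : Type*} [Group Γ] [Countable Γ] (hlef : IsLEF Γ)
    (ham : IsAmenable Γ) : IsWeaklyLocallyStable Γ := by
  intro k hk φ hφ hsep
  obtain ⟨A, hA⟩ := exists_exhausting_finset Γ
  choose T δ hδ hT using fun j : ℕ =>
    hlef.exists_window ham (A j) (ε := 1 / ((j : ℝ) + 1)) (by positivity)
  let J : ℕ → ℕ := fun n => Nat.findGreatest (fun j => IsGood (T j) (δ j) (φ n)) n
  have hJ : Tendsto J atTop atTop := by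
    rw [tendsto_atTop]
    intro j
    filter_upwards [eventually_isGood hk hφ hsep (T j) (hδ j), eventually_ge_atTop j] with n h1 h2
    exact Nat.le_findGreatest h2 h1
  have hJgood : ∀ᶠ n in atTop, IsGood (T (J n)) (δ (J n)) (φ n) := by
    filter_upwards [hJ.eventually_ge_atTop 1] with n hn
    exact Nat.findGreatest_of_ne_zero (P := fun j => IsGood (T j) (δ j) (φ n)) (n := n)
      (m := J n) rfl (by omega)
  have hex : ∀ n, ∃ ψ : Γ → Equiv.Perm (Fin (k n)), IsGood (T (J n)) (δ (J n)) (φ n) →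
      (∀ g ∈ A (J n), ∀ h ∈ A (J n), ψ (g * h) = ψ g * ψ h) ∧
        ∀ g ∈ A (J n), dHam (φ n g) (ψ g) ≤ 1 / ((J n : ℝ) + 1) := by
    intro n
    by_cases h : IsGood (T (J n)) (δ (J n)) (φ n)
    · obtain ⟨ψ, hψ⟩ := hT (J n) (k n) (hk n) (φ n) h
      exact ⟨ψ, fun _ => hψ⟩
    · exact ⟨φ n, fun h' => absurd h' h⟩
  choose ψ hψ using hex
  refine ⟨ψ, fun g h => ?_, fun g => ?_⟩
  · filter_upwards [hJgood, hJ.eventually (hA g), hJ.eventually (hA h)] with n h1 h2 h3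
    exact (hψ n h1).1 g h2 h h3
  · refine squeeze_zero' (Eventually.of_forall fun n => dHam_nonneg _ _) ?_
      (tendsto_one_div_add_atTop_nhds_zero_nat.comp hJ)
    filter_upwards [hJgood, hJ.eventually (hA g)] with n h1 h2
    exact (hψ n h1).2 g h2

/-- Left translations of a finite set, completed to permutations. -/
lemma exists_perm_translation {Γ : Type*} [Group Γ] (F : Finset Γ) (g : Γ) :
    ∃ σ : Equiv.Perm (Fin F.card), ∀ i, g * (F.equivFin.symm i : Γ) ∈ F →
      (F.equivFin.symm (σ i) : Γ) = g * F.equivFin.symm i := by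
  obtain ⟨σ, hσ⟩ := Finset.exists_equiv_extend_of_card_eq (t := F)
    (s := Finset.univ.filter fun i : Fin F.card => g * (F.equivFin.symm i : Γ) ∈ F)
    (f := fun i => g * (F.equivFin.symm i : Γ)) (by simp)
    (by
      intro x hx
      obtain ⟨i, hi, rfl⟩ := Finset.mem_image.1 hx
      exact (Finset.mem_filter.1 hi).2)
    (fun a _ b _ hab => by simpa using hab)
  refine ⟨σ.trans F.equivFin, fun i hi => ?_⟩
  simpa using hσ i (Finset.mem_filter.2 ⟨Finset.mem_univ _, hi⟩)

lemma card_filter_equivFin {Γ : Type*} [Group Γ] (F : Finset Γ) (p : Γ → Prop)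
    [DecidablePred p] :
    (Finset.univ.filter fun i => p (F.equivFin.symm i : Γ)).card = (F.filter p).card := by
  refine Finset.card_bij (fun i _ => (F.equivFin.symm i : Γ)) ?_ ?_ ?_
  · intro i hi
    simpa using hi
  · intro i _ j _ h
    simpa using h
  · intro x hx
    obtain ⟨hxF, hpx⟩ := Finset.mem_filter.1 hx
    exact ⟨F.equivFin ⟨x, hxF⟩, by simpa using hpx, by simp⟩

theorem IsAmenable.isSofic {Γ : Type*} [Group Γ] [Countable Γ] (ham : IsAmenable Γ) :
    IsSofic Γ := by
  obtain ⟨A, hA⟩ := exists_exhausting_finset Γ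
  choose F hF hFA using fun n : ℕ =>
    ham.exists_isFolner (A n) (η := 1 / ((n : ℝ) + 1)) (by positivity)
  choose φ hφ using fun n g => exists_perm_translation (F n) g
  let b : Γ → ℕ → ℝ := fun g n => ((F n).filter fun f => g * f ∉ F n).card / (F n).card
  have hpos : ∀ n, (0 : ℝ) < (F n).card := fun n => by exact_mod_cast (hF n).card_pos
  have hb : ∀ g, Tendsto (b g) atTop (𝓝 0) := by
    intro g
    refine squeeze_zero' (Eventually.of_forall fun n => by positivity) ?_
      tendsto_one_div_add_atTop_nhds_zero_nat
    filter_upwards [hA g] with n hn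
    exact (div_le_iff₀ (hpos n)).2 (hFA n g hn).1
  have hinj : ∀ n (i j : Fin (F n).card),
      ((F n).equivFin.symm i : Γ) = (F n).equivFin.symm j → i = j := by
    intro n i j h
    simpa using h
  refine ⟨fun n => (F n).card, fun n => (hF n).card_pos, φ, fun g h => ?_, fun g hg => ?_⟩
  · refine squeeze_zero (fun n => dHam_nonneg _ _) (fun n => ?_)
      (by simpa using (hb h).add (hb (g * h)))
    simp only [dHam, b]
    rw [← add_div]
    refine div_le_div_of_nonneg_right ?_ (hpos n).le
    rw [← card_filter_equivFin (F n) fun f => h * f ∉ F n,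
      ← card_filter_equivFin (F n) fun f => g * h * f ∉ F n, ← Nat.cast_add, Nat.cast_le]
    refine (Finset.card_le_card ?_).trans (Finset.card_union_le _ _)
    intro i hi
    simp only [Finset.mem_filter, Finset.mem_univ, true_and, Finset.mem_union] at hi ⊢
    rw [Equiv.Perm.mul_apply] at hi
    by_contra! H
    apply hi
    apply hinj
    have h1 := hφ n h i H.1
    rw [hφ n g _ (by rw [h1, ← mul_assoc]; exact H.2), hφ n (g * h) i H.2, h1, mul_assoc]
  · refine tendsto_of_tendsto_of_tendsto_of_le_of_le (g := fun n => 1 - b g n) (h := fun _ => 1)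
      (by simpa using (hb g).const_sub 1) tendsto_const_nhds (fun n => ?_)
      (fun n => dHam_le_one _ _)
    have h1 := card_agree_div (hF n).card_pos (φ n g) 1
    have h2 : ((Finset.univ.filter fun x => φ n g x =
        (1 : Equiv.Perm (Fin (F n).card)) x).card : ℝ) / (F n).card ≤ b g n := by
      simp only [b]
      refine div_le_div_of_nonneg_right ?_ (hpos n).le
      rw [← card_filter_equivFin (F n) fun f => g * f ∉ F n, Nat.cast_le]
      refine Finset.card_le_card fun i hi => ?_
      simp only [Finset.mem_filter, Finset.mem_univ, true_and] at hi ⊢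
      intro h
      have h3 := hφ n g i h
      rw [hi, Equiv.Perm.one_apply] at h3
      exact hg (by simpa using h3)
    change 1 - b g n ≤ dHam (φ n g) 1
    linarith

theorem IsWeaklyLocallyStable.isLEF {Γ : Type*} [Group Γ] (h : IsWeaklyLocallyStable Γ)
    (hsof : IsSofic Γ) : IsLEF Γ := by
  obtain ⟨k, hk, φ, hφ, hsep⟩ := hsof
  obtain ⟨ψ, hψ, hclose⟩ := h k hk φ hφ hsep
  refine ⟨k, hk, ψ, hψ, fun g hg => ?_⟩
  refine tendsto_of_tendsto_of_tendsto_of_le_of_le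
    (g := fun n => dHam (φ n g) 1 - dHam (φ n g) (ψ n g)) (h := fun _ => 1)
    (by simpa using (hsep g hg).sub (hclose g)) tendsto_const_nhds (fun n => ?_)
    (fun n => dHam_le_one _ _)
  have := dHam_triangle (φ n g) (ψ n g) 1
  change dHam (φ n g) 1 - dHam (φ n g) (ψ n g) ≤ dHam (ψ n g) 1
  linarith

lemma Group.FG.countable {Γ : Type*} [Group Γ] (h : Group.FG Γ) : Countable Γ := by
  obtain ⟨S, _, f, hf⟩ := Group.fg_iff_exists_freeGroup_hom_surjective_finite.1 h
  exact hf.countable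

/-- A finitely generated amenable group is weakly locally stable iff it is LEF. -/
theorem weaklyLocallyStable_iff_lef_of_amenable (Γ : Type) [Group Γ]
    (hfg : Group.FG Γ) (ham : IsAmenable Γ) :
    IsWeaklyLocallyStable Γ ↔ IsLEF Γ := by
  have := Group.FG.countable hfg
  exact ⟨fun h => h.isLEF ham.isSofic, fun h => h.isWeaklyLocallyStable ham⟩
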